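/- Let N = 1 and s ∈ (0,1). Assume K satisfies (K1) and (K2) and W satisfies (W1)–(W4). Let u0 be the odd, strictly increasing class A minimizer of Theorem 1 (u0 : ℝ → (−1,1) of class C^{1+2s+α}(ℝ) for some α > 0, u0(0) = 0, lim_{x→±∞} u0(x) = ±1, solving L_K u0 = W'(u0) pointwise on ℝ). Then u0 is the unique non-decreasing solution of L_K u = W'(u) in the class X up to translations: if u ∈ X is non-decreasing, belongs to L¹_s(ℝ) ∩ C^{2s+γ}_loc(ℝ) for some γ > 0, and satisfies L_K u = W'(u) at every point of ℝ, then there exists x0 ∈ ℝ such that u(x) = u0(x − x0) for every x ∈ ℝ. -/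

import Mathlib

open MeasureTheory Filter Topology Set
open scoped ENNReal NNReal

noncomputable section

/-- The non-local Gagliardo-type + potential energy `E_K(u, Ω)`. -/
def nlEnergy {E : Type*} [MeasurableSpace E] [Sub E] (μ : Measure E)
    (K : E → ℝ) (W : ℝ → ℝ) (u : E → ℝ) (Ω : Set E) : ℝ≥0∞ :=
  (1 / 4) * ∫⁻ p in ((Ωᶜ ×ˢ Ωᶜ)ᶜ : Set (E × E)),
      ENNReal.ofReal ((u p.1 - u p.2) ^ 2 * K (p.1 - p.2)) ∂(μ.prod μ)
    + ∫⁻ x in Ω, ENNReal.ofReal (W (u x)) ∂μ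

/-- `u` is a local minimizer of `E_K` in `Ω`. -/
def IsLocalMinimizer {E : Type*} [MeasurableSpace E] [Sub E] (μ : Measure E)
    (K : E → ℝ) (W : ℝ → ℝ) (u : E → ℝ) (Ω : Set E) : Prop :=
  nlEnergy μ K W u Ω ≠ ⊤ ∧
    ∀ v : E → ℝ, Measurable v → (∀ᵐ x ∂μ, x ∉ Ω → v x = u x) →
      nlEnergy μ K W u Ω ≤ nlEnergy μ K W v Ω

/-- `u` is a class A minimizer of `E_K`: a local minimizer in every bounded domain. -/
def IsClassAMinimizer {E : Type*} [NormedAddCommGroup E] [MeasurableSpace E] (μ : Measure E)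
    (K : E → ℝ) (W : ℝ → ℝ) (u : E → ℝ) : Prop :=
  ∀ Ω : Set E, IsOpen Ω → IsConnected Ω → Bornology.IsBounded Ω →
    IsLocalMinimizer μ K W u Ω

/-- The integro-differential operator `L_K`, in its non-singular form
`L_K u (x) = (1/2) ∫ (u(x+z) + u(x-z) - 2 u(x)) K(z) dz`. -/
def opLK {E : Type*} [NormedAddCommGroup E] [MeasurableSpace E] (μ : Measure E)
    (K : E → ℝ) (u : E → ℝ) (x : E) : ℝ :=
  (1 / 2) * ∫ z, (u (x + z) + u (x - z) - 2 * u x) * K z ∂μ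

/-- (K1): the kernel is symmetric. -/
def KernelSymm {E : Type*} [MeasurableSpace E] [Neg E] (μ : Measure E) (K : E → ℝ) : Prop :=
  ∀ᵐ z ∂μ, K (-z) = K z

/-- (K2): `λ χ_{B_{r0}}(z) |z|^{-N-2s} ≤ K(z) ≤ Λ |z|^{-N-2s}` for a.e. `z`. -/
def KernelK2 {E : Type*} [NormedAddCommGroup E] [MeasurableSpace E] (μ : Measure E)
    (K : E → ℝ) (N : ℕ) (s lam Lam r0 : ℝ) : Prop :=
  ∀ᵐ z ∂μ, K z ≤ Lam * ‖z‖ ^ (-(N : ℝ) - 2 * s) ∧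
    (‖z‖ < r0 → lam * ‖z‖ ^ (-(N : ℝ) - 2 * s) ≤ K z)

/-- (K2'): `λ |z|^{-N-2s} ≤ K(z) ≤ Λ |z|^{-N-2s}` for a.e. `z`. -/
def KernelK2' {E : Type*} [NormedAddCommGroup E] [MeasurableSpace E] (μ : Measure E)
    (K : E → ℝ) (N : ℕ) (s lam Lam : ℝ) : Prop :=
  ∀ᵐ z ∂μ, lam * ‖z‖ ^ (-(N : ℝ) - 2 * s) ≤ K z ∧ K z ≤ Lam * ‖z‖ ^ (-(N : ℝ) - 2 * s)

/-- `W` is of class `C^{2,β}_loc(ℝ)`. -/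
def IsC2HolderLoc (β : ℝ) (W : ℝ → ℝ) : Prop :=
  ContDiff ℝ 2 W ∧ ∀ R : ℝ, 0 < R → ∃ C : NNReal,
    HolderOnWith C β.toNNReal (deriv (deriv W)) (Icc (-R) R)

/-- `f` is of (global) class `C^γ`: it is `C^{⌊γ⌋}` and the `⌊γ⌋`-th derivative is
globally Hölder continuous with exponent `γ - ⌊γ⌋`. -/
def IsCHolder {E F : Type*} [NormedAddCommGroup E] [NormedSpace ℝ E]
    [NormedAddCommGroup F] [NormedSpace ℝ F] (γ : ℝ) (f : E → F) : Prop :=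
  ContDiff ℝ (⌊γ⌋₊ : ℕ) f ∧ ∃ C : NNReal,
    HolderWith C (γ - ⌊γ⌋₊).toNNReal (iteratedFDeriv ℝ ⌊γ⌋₊ f)

/-- `f` is of class `C^γ` on the set `Ω`. -/
def IsCHolderOn {E F : Type*} [NormedAddCommGroup E] [NormedSpace ℝ E]
    [NormedAddCommGroup F] [NormedSpace ℝ F] (γ : ℝ) (f : E → F) (Ω : Set E) : Prop :=
  ContDiffOn ℝ (⌊γ⌋₊ : ℕ) f Ω ∧ ∃ C : NNReal,
    HolderOnWith C (γ - ⌊γ⌋₊).toNNReal (iteratedFDerivWithin ℝ ⌊γ⌋₊ f Ω) Ω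

/-- The scaling factor `Ψ_s(R)`. -/
def Psi (s R : ℝ) : ℝ :=
  if s < 1 / 2 then R ^ (1 - 2 * s) else if s = 1 / 2 then Real.log R else 1


/-- The centred second difference of `f` at `x` with increment `z`. -/
def secondDiff (f : ℝ → ℝ) (x z : ℝ) : ℝ := f (x + z) + f (x - z) - 2 * f x

theorem opLK_eq_secondDiff (K f : ℝ → ℝ) (x : ℝ) :
    opLK volume K f x = (1 / 2) * ∫ z, secondDiff f x z * K z := rfl

theorem continuous_secondDiff {f : ℝ → ℝ} (hf : Continuous f) (x : ℝ) :
    Continuous (secondDiff f x) := by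
  unfold secondDiff
  fun_prop

theorem secondDiff_comp_add_const (f : ℝ → ℝ) (t x z : ℝ) :
    secondDiff (fun y => f (y + t)) x z = secondDiff f (x + t) z := by
  simp only [secondDiff]
  rw [show x + z + t = x + t + z by ring, show x - z + t = x + t - z by ring]

theorem opLK_comp_add_const (K f : ℝ → ℝ) (t x : ℝ) :
    opLK volume K (fun y => f (y + t)) x = opLK volume K f (x + t) := by
  simp only [opLK_eq_secondDiff, secondDiff_comp_add_const]

theorem secondDiff_sub (f g : ℝ → ℝ) (x z : ℝ) :
    secondDiff (fun y => f y - g y) x z = secondDiff f x z - secondDiff g x z := by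
  simp only [secondDiff]
  ring

/-- A continuous function vanishing at `±∞` and negative somewhere has a negative minimum. -/
theorem exists_negative_min {w : ℝ → ℝ} (hw : Continuous w) (htop : Tendsto w atTop (𝓝 0))
    (hbot : Tendsto w atBot (𝓝 0)) {x : ℝ} (hx : w x < 0) :
    ∃ m, w m < 0 ∧ ∀ y, w m ≤ w y := by
  obtain ⟨m, hm⟩ := hw.exists_forall_le' x (by
    rw [cocompact_eq_atBot_atTop, eventually_sup]
    exact ⟨(hbot.eventually (lt_mem_nhds hx)).mono fun _ h => h.le,
      (htop.eventually (lt_mem_nhds hx)).mono fun _ h => h.le⟩)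
  exact ⟨m, (hm x).trans_lt hx, hm⟩

/-- At a minimum point of `f - g` the operators of `f` and `g` are ordered. -/
theorem opLK_le_of_min_sub {K f g : ℝ → ℝ} (hK : ∀ᵐ z, 0 ≤ K z) {m : ℝ}
    (hf : Integrable fun z => secondDiff f m z * K z)
    (hg : Integrable fun z => secondDiff g m z * K z)
    (hm : ∀ y, f m - g m ≤ f y - g y) : opLK volume K g m ≤ opLK volume K f m := by
  rw [opLK_eq_secondDiff, opLK_eq_secondDiff]
  gcongr ?_ * ?_
  refine integral_mono_ae hg hf ?_
  filter_upwards [hK] with z hz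
  refine mul_le_mul_of_nonneg_right ?_ hz
  have h1 := hm (m + z)
  have h2 := hm (m - z)
  simp only [secondDiff]
  linarith

/-- Strong maximum principle: a continuous `f - g` which attains its minimum at a point where the
operators of `f` and `g` agree is constant near that point. -/
theorem eq_of_min_sub_of_opLK_eq {K f g : ℝ → ℝ} {r0 : ℝ} (hK : ∀ᵐ z, 0 ≤ K z)
    (hKpos : ∀ᵐ z, |z| < r0 → 0 < K z) (hfc : Continuous f) (hgc : Continuous g) {m : ℝ}
    (hf : Integrable fun z => secondDiff f m z * K z)
    (hg : Integrable fun z => secondDiff g m z * K z)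
    (hm : ∀ y, f m - g m ≤ f y - g y) (heq : opLK volume K g m = opLK volume K f m)
    {z : ℝ} (hz : |z| < r0) : f (m + z) - g (m + z) = f m - g m := by
  have hwn : ∀ z, 0 ≤ secondDiff f m z - secondDiff g m z := fun z => by
    have h1 := hm (m + z)
    have h2 := hm (m - z)
    simp only [secondDiff]
    linarith
  have hint : ∫ z, (secondDiff f m z - secondDiff g m z) * K z = 0 := by
    simp only [sub_mul]
    rw [integral_sub hf hg]
    rw [opLK_eq_secondDiff, opLK_eq_secondDiff] at heq
    linarith
  rw [integral_eq_zero_iff_of_nonneg_ae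
    (by filter_upwards [hK] with z hz using mul_nonneg (hwn z) hz)
    (by simp only [sub_mul]; exact hf.sub hg)] at hint
  have hae : ∀ᵐ z ∂(volume.restrict (Metric.ball (0 : ℝ) r0)),
      secondDiff f m z - secondDiff g m z = 0 := by
    refine (ae_restrict_iff' measurableSet_ball).2 ?_
    filter_upwards [hint, hKpos] with z h1 h2 h3
    rw [mem_ball_zero_iff, Real.norm_eq_abs] at h3
    exact (mul_eq_zero.1 h1).resolve_right (h2 h3).ne'
  have hon := Measure.eqOn_open_of_ae_eq hae Metric.isOpen_ball
    ((continuous_secondDiff hfc m).sub (continuous_secondDiff hgc m)).continuousOn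
    continuousOn_const
  have h0 := hon (x := z) (by simpa using hz)
  have h1 := hm (m + z)
  have h2 := hm (m - z)
  simp only [secondDiff] at h0
  linarith

/-- A continuous function with values at distance less than `r` from a given one which are locally
constant in balls of fixed radius is constant. -/
theorem eq_const_of_propagation {w : ℝ → ℝ} {c r : ℝ} (hr : 0 < r) {m : ℝ} (hm : w m = c)
    (hstep : ∀ x, w x = c → ∀ z, |z| < r → w (x + z) = c) (y : ℝ) : w y = c := by
  obtain ⟨n, hn⟩ := exists_nat_gt (|y - m| / r)
  have hnpos : (0 : ℝ) < n := lt_of_le_of_lt (by positivity) hn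
  have key : ∀ k : ℕ, w (m + k * ((y - m) / n)) = c := by
    intro k
    induction k with
    | zero => simpa using hm
    | succ k ih =>
      have := hstep _ ih ((y - m) / n) (by
        rw [abs_div, abs_of_pos hnpos, div_lt_iff₀ hnpos]
        rw [div_lt_iff₀ hr] at hn
        linarith)
      rw [← this]
      push_cast
      ring_nf
  have := key n
  rwa [mul_div_cancel₀ _ hnpos.ne', add_sub_cancel] at this

theorem exists_strictMonoOn_of_deriv_pos {h : ℝ → ℝ} (hc : ContDiff ℝ 1 h) {c : ℝ}
    (hpos : 0 < deriv h c) : ∃ δ > 0, StrictMonoOn h (Icc (c - δ) (c + δ)) := by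
  have hev : ∀ᶠ x in 𝓝 c, 0 < deriv h x :=
    (hc.continuous_deriv le_rfl).continuousAt.eventually (lt_mem_nhds hpos)
  obtain ⟨ε, hε, hball⟩ := Metric.eventually_nhds_iff_ball.1 hev
  refine ⟨ε, hε, strictMonoOn_of_deriv_pos (convex_Icc _ _) hc.continuous.continuousOn ?_⟩
  intro x hx
  rw [interior_Icc] at hx
  exact hball x (by rwa [Real.ball_eq_Ioo])

theorem tendsto_comp_add_const_atTop {u : ℝ → ℝ} {l : ℝ} (hu : Tendsto u atTop (𝓝 l)) (t : ℝ) :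
    Tendsto (fun x => u (x + t)) atTop (𝓝 l) :=
  hu.comp (tendsto_atTop_add_const_right _ _ tendsto_id)

theorem tendsto_comp_add_const_atBot {u : ℝ → ℝ} {l : ℝ} (hu : Tendsto u atBot (𝓝 l)) (t : ℝ) :
    Tendsto (fun x => u (x + t)) atBot (𝓝 l) :=
  hu.comp (tendsto_atBot_add_const_right _ _ tendsto_id)

/-- Uniqueness up to translations of increasing layer solutions for a nonnegative kernel which is
positive near the origin, by the sliding method. -/
theorem exists_translation_of_nonneg_kernel {K h u v : ℝ → ℝ} {r0 : ℝ} (hr0 : 0 < r0)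
    (hK : ∀ᵐ z, 0 ≤ K z) (hKpos : ∀ᵐ z, |z| < r0 → 0 < K z)
    (hh : ContDiff ℝ 1 h) (hh1 : 0 < deriv h 1) (hh2 : 0 < deriv h (-1))
    (hvc : Continuous v) (hvm : Monotone v)
    (hv0 : -1 < v 0) (hvtop : Tendsto v atTop (𝓝 1)) (hvbot : Tendsto v atBot (𝓝 (-1)))
    (hvint : ∀ x, Integrable fun z => secondDiff v x z * K z)
    (hvsol : ∀ x, opLK volume K v x = h (v x))
    (huc : Continuous u) (hum : Monotone u)
    (hutop : Tendsto u atTop (𝓝 1)) (hubot : Tendsto u atBot (𝓝 (-1)))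
    (huint : ∀ x, Integrable fun z => secondDiff u x z * K z)
    (husol : ∀ x, opLK volume K u x = h (u x)) :
    ∃ x0 : ℝ, ∀ x : ℝ, u x = v (x - x0) := by
  have hu1 : ∀ x, u x ≤ 1 := hum.ge_of_tendsto hutop
  have hu2 : ∀ x, -1 ≤ u x := hum.le_of_tendsto hubot
  have hv1 : ∀ x, v x ≤ 1 := hvm.ge_of_tendsto hvtop
  have hv2 : ∀ x, -1 ≤ v x := hvm.le_of_tendsto hvbot
  obtain ⟨δ, hδ, hmono1⟩ := exists_strictMonoOn_of_deriv_pos hh hh1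
  obtain ⟨δ', hδ', hmono2⟩ := exists_strictMonoOn_of_deriv_pos hh hh2
  have hle : ∀ t m, (∀ y, u (m + t) - v m ≤ u (y + t) - v y) → h (v m) ≤ h (u (m + t)) := by
    intro t m hm
    rw [← hvsol, ← husol, ← opLK_comp_add_const]
    refine opLK_le_of_min_sub hK ?_ (hvint m) hm
    simpa only [secondDiff_comp_add_const] using huint (m + t)
  have hneg : ∀ t, (∃ x, u (x + t) < v x) →
      ∃ m, u (m + t) < v m ∧ 1 - δ > u (m + t) ∧ v m > -1 + δ' := by
    rintro t ⟨x, hx⟩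
    obtain ⟨m, hm0, hm⟩ := exists_negative_min (w := fun x => u (x + t) - v x) (by fun_prop)
      (by simpa using (tendsto_comp_add_const_atTop hutop t).sub hvtop)
      (by simpa using (tendsto_comp_add_const_atBot hubot t).sub hvbot)
      (sub_neg.2 hx)
    have hm1 := sub_neg.1 hm0
    have hcmp := hle t m hm
    refine ⟨m, hm1, ?_, ?_⟩
    · by_contra! hcon
      exact absurd (hmono1 ⟨hcon, by linarith [hu1 (m + t)]⟩
        ⟨by linarith, by linarith [hv1 m]⟩ hm1) (not_lt.2 hcmp)
    · by_contra! hcon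
      exact absurd (hmono2 ⟨by linarith [hu2 (m + t)], by linarith⟩
        ⟨by linarith [hv2 m], hcon⟩ hm1) (not_lt.2 hcmp)
  obtain ⟨A, hA⟩ : ∃ A, ∀ x ≤ A, v x ≤ -1 + δ' :=
    eventually_atBot.1 ((hvbot.eventually (gt_mem_nhds (by linarith : -1 < -1 + δ'))).mono
      fun _ h => h.le)
  obtain ⟨B, hB⟩ : ∃ B, ∀ x ≥ B, 1 - δ ≤ u x :=
    eventually_atTop.1 ((hutop.eventually (lt_mem_nhds (by linarith : 1 - δ < 1))).mono
      fun _ h => h.le)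
  set S : Set ℝ := {t | ∀ x, v x ≤ u (x + t)} with hS
  have hSne : S.Nonempty := by
    refine ⟨B - A, fun x => ?_⟩
    by_contra! hx
    obtain ⟨m, hm1, hm2, hm3⟩ := hneg _ ⟨x, hx⟩
    rcases le_total m A with h | h
    · linarith [hA m h]
    · linarith [hB (m + (B - A)) (by linarith)]
  have hSbdd : BddBelow S := by
    obtain ⟨C, hC⟩ := eventually_atBot.1 (hubot.eventually (gt_mem_nhds hv0))
    refine ⟨C, fun t ht => ?_⟩
    by_contra! hcon
    have h1 := ht 0
    have h2 := hC t hcon.le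
    rw [zero_add] at h1
    linarith
  have hSclosed : IsClosed S := by
    rw [hS, ofPred_forall]
    exact isClosed_iInter fun x => isClosed_le continuous_const (by fun_prop)
  set T := sInf S with hT
  have hTS : T ∈ S := hSclosed.csInf_mem hSne hSbdd
  have htouch : ∃ m, u (m + T) - v m = 0 := by
    by_contra! hcon
    have hpos : ∀ x, 0 < u (x + T) - v x := fun x =>
      lt_of_le_of_ne (sub_nonneg.2 (hTS x)) (hcon x).symm
    set M := max A (B - T + 1) with hM
    have hnear : ∀ᶠ t in 𝓝 T, ∀ x ∈ Icc A M, 0 < u (x + t) - v x := by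
      refine isCompact_Icc.eventually_forall_of_forall_eventually fun x _ => ?_
      have hcont : Continuous fun p : ℝ × ℝ => u (p.2 + p.1) - v p.2 := by fun_prop
      exact hcont.continuousAt.eventually (lt_mem_nhds (hpos x))
    obtain ⟨ε, hε, hball⟩ := Metric.eventually_nhds_iff_ball.1 hnear
    set t := T - min (ε / 2) 1 with ht
    have hmin : 0 < min (ε / 2) 1 := by positivity
    have htb : t ∈ Metric.ball T ε := by
      rw [Real.ball_eq_Ioo]
      constructor <;> linarith [min_le_left (ε / 2) 1]
    have htS : t ∈ S := by
      intro x
      by_contra! hx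
      obtain ⟨m, hm1, hm2, hm3⟩ := hneg _ ⟨x, hx⟩
      rcases le_total m A with h | h
      · linarith [hA m h]
      · rcases le_total m M with h' | h'
        · linarith [hball t htb m ⟨h, h'⟩]
        · linarith [hB (m + t) (by linarith [min_le_right (ε / 2) 1, le_max_right A (B - T + 1)])]
    linarith [csInf_le hSbdd htS]
  obtain ⟨m, hm⟩ := htouch
  have hall := eq_const_of_propagation (w := fun x => u (x + T) - v x) hr0 hm (by
    intro x hx z hz
    refine (eq_of_min_sub_of_opLK_eq (f := fun y => u (y + T)) (g := v) (m := x) hK hKpos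
      (by fun_prop) hvc ?_ (hvint x) (fun y => ?_) ?_ hz).trans hx
    · simpa only [secondDiff_comp_add_const] using huint (x + T)
    · rw [hx]
      exact sub_nonneg.2 (hTS y)
    · rw [opLK_comp_add_const, husol, hvsol, sub_eq_zero.1 hx])
  refine ⟨T, fun x => ?_⟩
  have := hall (x - T)
  simp only [sub_add_cancel] at this
  linarith

/-- Second differences of a function with Hölder continuous derivative. -/
theorem abs_secondDiff_le_of_deriv {f : ℝ → ℝ} {R C r : ℝ} (hr : 0 ≤ r) (hC : 0 ≤ C)
    (hf : ∀ y ∈ Icc (-(R + 1)) (R + 1), DifferentiableAt ℝ f y)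
    (hf' : ∀ a ∈ Icc (-(R + 1)) (R + 1), ∀ b ∈ Icc (-(R + 1)) (R + 1),
      |deriv f a - deriv f b| ≤ C * |a - b| ^ r)
    {x z : ℝ} (hx : |x| ≤ R) (hz : |z| ≤ 1) :
    |secondDiff f x z| ≤ C * 2 ^ r * |z| ^ (1 + r) := by
  have hx' := abs_le.1 hx
  have hmem : ∀ t ∈ Icc (-|z|) |z|, x + t ∈ Icc (-(R + 1)) (R + 1) ∧
      x - t ∈ Icc (-(R + 1)) (R + 1) := fun t ht =>
    ⟨⟨by linarith [ht.1], by linarith [ht.2]⟩, ⟨by linarith [ht.2], by linarith [ht.1]⟩⟩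
  have hder : ∀ t ∈ Icc (-|z|) |z|,
      HasDerivAt (fun t => f (x + t) + f (x - t)) (deriv f (x + t) - deriv f (x - t)) t := by
    intro t ht
    have h1 := (hf _ (hmem t ht).1).hasDerivAt.comp_const_add x t
    have h2 := (hf _ (hmem t ht).2).hasDerivAt.comp_const_sub x t
    exact (h1.add h2).congr_deriv (by ring)
  have key := (convex_Icc (-|z|) |z|).norm_image_sub_le_of_norm_deriv_le
    (f := fun t => f (x + t) + f (x - t)) (C := C * (2 * |z|) ^ r) (x := 0) (y := z)
    (fun t ht => (hder t ht).differentiableAt) (fun t ht => by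
      rw [(hder t ht).deriv, Real.norm_eq_abs]
      refine (hf' _ (hmem t ht).1 _ (hmem t ht).2).trans ?_
      rw [show x + t - (x - t) = 2 * t by ring, abs_mul, abs_two]
      have : |t| ≤ |z| := abs_le.2 ht
      gcongr)
    ⟨by simp, abs_nonneg z⟩ ⟨neg_abs_le z, le_abs_self z⟩
  simp only [add_zero, sub_zero, Real.norm_eq_abs] at key
  have h0 : secondDiff f x z = f (x + z) + f (x - z) - (f x + f x) := by
    simp only [secondDiff]
    ring
  rw [h0]
  refine key.trans (le_of_eq ?_)
  rw [Real.mul_rpow (by norm_num) (abs_nonneg z), Real.rpow_add' (abs_nonneg z) (by linarith),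
    Real.rpow_one]
  ring

theorem HolderOnWith.abs_iteratedDerivWithin_sub_le {C : ℝ≥0} {r : ℝ} (hr : 0 ≤ r) {k : ℕ}
    {f : ℝ → ℝ} {Ω : Set ℝ} (h : HolderOnWith C r.toNNReal (iteratedFDerivWithin ℝ k f Ω) Ω)
    {a b : ℝ} (ha : a ∈ Ω) (hb : b ∈ Ω) :
    |iteratedDerivWithin k f Ω a - iteratedDerivWithin k f Ω b| ≤ C * |a - b| ^ r := by
  have := h.dist_le ha hb
  rwa [iteratedFDerivWithin_eq_equiv_comp, Function.comp_apply, Function.comp_apply,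
    LinearIsometryEquiv.dist_map, Real.dist_eq, Real.dist_eq, Real.coe_toNNReal _ hr] at this

theorem exists_abs_secondDiff_le_rpow {f : ℝ → ℝ} {p : ℝ} (hp : 0 < p)
    (h : ∀ R : ℝ, 0 < R → IsCHolderOn p f (Ioo (-R) R)) {R : ℝ} (hR : 0 < R) :
    ∃ C, 0 ≤ C ∧ ∀ x z, |x| ≤ R → |z| ≤ 1 → |secondDiff f x z| ≤ C * |z| ^ min p 2 := by
  set Ω := Ioo (-(R + 2)) (R + 2) with hΩ
  have hΩo : IsOpen Ω := isOpen_Ioo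
  have hsub : Icc (-(R + 1)) (R + 1) ⊆ Ω := fun y hy => ⟨by linarith [hy.1], by linarith [hy.2]⟩
  obtain ⟨hreg, C, hC⟩ := h (R + 2) (by linarith)
  have hk : (⌊p⌋₊ : ℝ) ≤ p := Nat.floor_le hp.le
  have hk' : p < ⌊p⌋₊ + 1 := Nat.lt_floor_add_one p
  have hbound := fun a ha b hb => HolderOnWith.abs_iteratedDerivWithin_sub_le (a := a) (b := b)
    (sub_nonneg.2 hk) hC ha hb
  have hdiff : 1 ≤ ⌊p⌋₊ → ∀ y ∈ Icc (-(R + 1)) (R + 1), DifferentiableAt ℝ f y := fun h1 y hy =>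
    (hreg.contDiffAt (hΩo.mem_nhds (hsub hy))).differentiableAt
      (by exact_mod_cast Nat.one_le_iff_ne_zero.1 h1)
  rcases lt_trichotomy ⌊p⌋₊ 1 with h0 | h1 | h2
  · have h0 : ⌊p⌋₊ = 0 := by omega
    rw [h0] at hbound hk'
    simp only [Nat.cast_zero, sub_zero, zero_add, iteratedDerivWithin_zero] at hbound hk'
    refine ⟨2 * C, by positivity, fun x z hx hz => ?_⟩
    rw [min_eq_left (by linarith)]
    have hx' := abs_le.1 hx
    have hz' := abs_le.1 hz
    have hx0 : x ∈ Ω := hsub ⟨by linarith, by linarith⟩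
    have e1 := hbound (x + z) (hsub ⟨by linarith, by linarith⟩) x hx0
    have e2 := hbound (x - z) (hsub ⟨by linarith, by linarith⟩) x hx0
    rw [add_sub_cancel_left] at e1
    rw [show x - z - x = -z by ring, abs_neg] at e2
    have : secondDiff f x z = (f (x + z) - f x) + (f (x - z) - f x) := by
      simp only [secondDiff]
      ring
    rw [this]
    refine (abs_add_le _ _).trans ?_
    linarith
  · rw [h1] at hbound hk'
    have hp1 : 0 ≤ p - 1 := by
      rw [h1, Nat.cast_one] at hk
      linarith
    simp only [Nat.cast_one, iteratedDerivWithin_one] at hbound hk'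
    refine ⟨C * 2 ^ (p - 1), by positivity, fun x z hx hz => ?_⟩
    have := abs_secondDiff_le_of_deriv (r := p - 1) hp1 C.coe_nonneg
      (hdiff h1.ge) (fun a ha b hb => by
        rw [← derivWithin_of_isOpen hΩo (hsub ha), ← derivWithin_of_isOpen hΩo (hsub hb)]
        exact hbound a (hsub ha) b (hsub hb)) hx hz
    rw [min_eq_left (by linarith)]
    simpa using this
  · have hp2 : (2 : ℝ) ≤ p := le_trans (by exact_mod_cast h2) hk
    have hd : ContDiffOn ℝ 1 (deriv f) (Icc (-(R + 1)) (R + 1)) :=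
      ((hreg.of_le (by exact_mod_cast h2 : ((1 + 1 : ℕ) : WithTop ℕ∞) ≤ (⌊p⌋₊ : ℕ))).deriv_of_isOpen
        hΩo (by norm_num)).mono hsub
    obtain ⟨K, hK⟩ := hd.exists_lipschitzOnWith one_ne_zero (convex_Icc _ _) isCompact_Icc
    refine ⟨K * 2 ^ (1 : ℝ), by positivity, fun x z hx hz => ?_⟩
    have := abs_secondDiff_le_of_deriv (r := 1) zero_le_one K.coe_nonneg
      (hdiff h2.le) (fun a ha b hb => by
        rw [Real.rpow_one]
        simpa only [Real.dist_eq] using hK.dist_le_mul a ha b hb) hx hz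
    rw [min_eq_right hp2]
    norm_num at this ⊢
    exact this

/-- Locally uniform bound for the second differences of a bounded function of class `C^p`. -/
theorem exists_abs_secondDiff_le_min {f : ℝ → ℝ} {p : ℝ} (hp : 0 < p)
    (h : ∀ R : ℝ, 0 < R → IsCHolderOn p f (Ioo (-R) R)) (hf : ∀ x, |f x| ≤ 1)
    {R : ℝ} (hR : 0 < R) :
    ∃ C, 0 ≤ C ∧ ∀ x z, |x| ≤ R → |secondDiff f x z| ≤ C * min 1 (|z| ^ min p 2) := by
  obtain ⟨C, hC, hb⟩ := exists_abs_secondDiff_le_rpow hp h hR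
  have hq : 0 ≤ min p 2 := le_min hp.le (by norm_num)
  refine ⟨C + 4, by linarith, fun x z hx => ?_⟩
  rcases le_total |z| 1 with hz | hz
  · rw [min_eq_right (Real.rpow_le_one (abs_nonneg z) hz hq)]
    refine (hb x z hx hz).trans ?_
    gcongr
    linarith
  · rw [min_eq_left (Real.one_le_rpow hz hq)]
    have h1 := abs_le.1 (hf (x + z))
    have h2 := abs_le.1 (hf (x - z))
    have h3 := abs_le.1 (hf x)
    simp only [secondDiff]
    rw [abs_le]
    constructor <;> linarith

theorem continuous_of_isCHolderOn {f : ℝ → ℝ} {p : ℝ}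
    (h : ∀ R : ℝ, 0 < R → IsCHolderOn p f (Ioo (-R) R)) : Continuous f := by
  refine continuous_iff_continuousAt.2 fun x => ?_
  have hx := abs_lt.1 (lt_add_one |x|)
  exact (h (|x| + 1) (by positivity)).1.continuousOn.continuousAt (Ioo_mem_nhds hx.1 hx.2)

theorem IsCHolder.isCHolderOn {f : ℝ → ℝ} {p : ℝ} (h : IsCHolder p f) {Ω : Set ℝ}
    (hΩ : IsOpen Ω) : IsCHolderOn p f Ω := by
  obtain ⟨h1, C, hC⟩ := h
  refine ⟨h1.contDiffOn, C, fun x hx y hy => ?_⟩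
  rw [iteratedFDerivWithin_of_isOpen _ hΩ hx, iteratedFDerivWithin_of_isOpen _ hΩ hy]
  exact hC x y

theorem integrable_comp_abs_of_integrableOn_Ioi {f : ℝ → ℝ} (h : IntegrableOn f (Ioi 0)) :
    Integrable fun x => f |x| := by
  have h1 : IntegrableOn (fun x => f |x|) (Ioi 0) :=
    h.congr_fun (fun x hx => by rw [abs_of_pos hx]) measurableSet_Ioi
  have h2 : IntegrableOn (fun x => f |x|) (Iic 0) := by
    rw [← Measure.map_neg_eq_self (volume : Measure ℝ)]
    let m : MeasurableEmbedding fun x : ℝ => -x := (Homeomorph.neg ℝ).measurableEmbedding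
    rw [m.integrableOn_map_iff]
    simp_rw [Function.comp_def, abs_neg, neg_preimage, neg_Iic, neg_zero]
    exact Iff.mpr integrableOn_Ici_iff_integrableOn_Ioi h1
  rw [← integrableOn_univ, ← Iic_union_Ioi (a := (0 : ℝ))]
  exact h2.union h1

/-- The truncated power `min 1 |z|^q` is integrable against a kernel of order `2s < q`. -/
theorem integrable_min_mul_kernel {P : ℝ → ℝ} (hP : Measurable P) {s q Lam : ℝ} (hs : 0 < s)
    (hq : 2 * s < q) (hP0 : ∀ᵐ z, 0 ≤ P z)
    (hPle : ∀ᵐ z, P z ≤ Lam * |z| ^ (-1 - 2 * s)) :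
    Integrable fun z => min 1 (|z| ^ q) * P z := by
  have hmaj : Integrable fun z : ℝ => min 1 (|z| ^ q) * (Lam * |z| ^ (-1 - 2 * s)) := by
    refine integrable_comp_abs_of_integrableOn_Ioi
      (f := fun z => min 1 (z ^ q) * (Lam * z ^ (-1 - 2 * s))) ?_
    rw [← Ioc_union_Ioi_eq_Ioi zero_le_one]
    refine IntegrableOn.union ?_ ?_
    · have := (intervalIntegrable_iff_integrableOn_Ioc_of_le zero_le_one).1
        (intervalIntegral.intervalIntegrable_rpow' (a := 0) (b := 1) (r := q + (-1 - 2 * s))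
          (by linarith))
      refine IntegrableOn.congr_fun (this.const_mul Lam) (fun z hz => ?_) measurableSet_Ioc
      rw [min_eq_right (Real.rpow_le_one hz.1.le hz.2 (by linarith)), Real.rpow_add hz.1]
      ring
    · have := integrableOn_Ioi_rpow_of_lt (a := -1 - 2 * s) (c := 1) (by linarith) one_pos
      refine IntegrableOn.congr_fun (this.const_mul Lam) (fun z hz => ?_) measurableSet_Ioi
      rw [min_eq_left (Real.one_le_rpow (le_of_lt hz) (by linarith)), one_mul]
  refine hmaj.mono' (by fun_prop) ?_
  filter_upwards [hP0, hPle] with z h1 h2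
  have h3 : 0 ≤ min 1 (|z| ^ q) := le_min zero_le_one (by positivity)
  rw [Real.norm_eq_abs, abs_of_nonneg (mul_nonneg h3 h1)]
  gcongr

theorem eq_zero_of_periodic_of_tendsto_zero {d : ℝ → ℝ} (hd : Tendsto d atTop (𝓝 0)) {x p : ℝ}
    (hp : 0 < p) (h : ∀ k : ℕ, d (x + k * p) = d x) : d x = 0 := by
  have h1 : Tendsto (fun k : ℕ => d (x + k * p)) atTop (𝓝 0) :=
    hd.comp (tendsto_atTop_add_const_left _ _
      (tendsto_natCast_atTop_atTop.atTop_mul_const hp))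
  simp only [h] at h1
  exact tendsto_nhds_unique tendsto_const_nhds h1

theorem secondDiff_neg_right (f : ℝ → ℝ) (x z : ℝ) : secondDiff f x (-z) = secondDiff f x z := by
  simp only [secondDiff, ← sub_eq_add_neg, sub_neg_eq_add]
  ring

theorem tendsto_increment_zero {v : ℝ → ℝ} {l : ℝ} (hv : Tendsto v atTop (𝓝 l)) (p : ℝ) :
    Tendsto (fun x => v (x + p) - v x) atTop (𝓝 0) := by
  simpa using (tendsto_comp_add_const_atTop hv p).sub hv

/-- A strictly increasing function with a limit at `+∞` has nonzero second differences of any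
given increment arbitrarily far away. -/
theorem exists_secondDiff_ne_zero {v : ℝ → ℝ} {l : ℝ} (hv : StrictMono v)
    (hvtop : Tendsto v atTop (𝓝 l)) (a : ℝ) {z : ℝ} (hz : z ≠ 0) :
    ∃ x ≥ a, secondDiff v x z ≠ 0 := by
  by_contra! hcon
  have habs : ∀ x ≥ a, secondDiff v x |z| = 0 := fun x hx => by
    rcases abs_choice z with h | h <;> rw [h]
    · exact hcon x hx
    · rw [secondDiff_neg_right]
      exact hcon x hx
  have hp : 0 < |z| := abs_pos.2 hz
  have h0 := eq_zero_of_periodic_of_tendsto_zero (tendsto_increment_zero hvtop |z|) (x := a) hp (by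
    intro k
    induction k with
    | zero => simp
    | succ k ih =>
      rw [← ih]
      have hk : a ≤ a + (k + 1 : ℕ) * |z| := by
        have : 0 ≤ ((k + 1 : ℕ) : ℝ) * |z| := by positivity
        linarith
      have h1 := habs _ hk
      simp only [secondDiff] at h1
      rw [show a + ((k + 1 : ℕ) : ℝ) * |z| - |z| = a + k * |z| by push_cast; ring] at h1
      rw [show a + (k : ℝ) * |z| + |z| = a + ((k + 1 : ℕ) : ℝ) * |z| by push_cast; ring]
      linarith)
  have := hv (lt_add_of_pos_right a hp)
  linarith

/-- A function against which the second differences of a layer function are integrable is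
integrable, provided it vanishes near the origin. -/
theorem integrable_of_integrable_secondDiff_mul {J v : ℝ → ℝ} {r0 a : ℝ} (hr0 : 0 < r0)
    (hJ : Measurable J) (hJ0 : ∀ᵐ z, |z| < r0 → J z = 0) (hvc : Continuous v)
    (hvm : StrictMono v) (hv0 : v 0 = 0) (hvtop : Tendsto v atTop (𝓝 1))
    (hvbot : Tendsto v atBot (𝓝 (-1)))
    (hint : ∀ x ≥ a, Integrable fun z => secondDiff v x z * J z) : Integrable J := by
  have hO : ∀ {l : Filter ℝ} {x b : ℝ}, b ≠ 0 → Tendsto (secondDiff v x) l (𝓝 b) →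
      J =O[l] fun z => secondDiff v x z * J z := by
    intro l x b hb hlim
    have hlim' := hlim.abs.eventually (lt_mem_nhds (half_lt_self (abs_pos.2 hb)))
    refine Asymptotics.IsBigO.of_bound (|b| / 2)⁻¹ (hlim'.mono fun z hz => ?_)
    have hb' : 0 < |b| / 2 := by positivity
    rw [norm_mul, Real.norm_eq_abs, Real.norm_eq_abs, ← div_eq_inv_mul, le_div_iff₀ hb', mul_comm]
    gcongr
  have hloc : LocallyIntegrable J := by
    intro z
    rcases eq_or_ne z 0 with rfl | hz
    · refine ⟨Metric.ball 0 r0, Metric.ball_mem_nhds _ hr0, ?_⟩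
      refine integrableOn_zero.congr ?_
      refine (ae_restrict_iff' measurableSet_ball).2 ?_
      filter_upwards [hJ0] with y hy hy'
      rw [mem_ball_zero_iff, Real.norm_eq_abs] at hy'
      exact (hy hy').symm
    · obtain ⟨x, hx, hne⟩ := exists_secondDiff_ne_zero hvm hvtop a hz
      exact (hO hne ((continuous_secondDiff hvc x).tendsto z)).integrableAtFilter
        hJ.stronglyMeasurable.stronglyMeasurableAtFilter ((hint x hx).integrableAtFilter _)
  set x := max a 1 with hx
  have hvx : 0 < v x := hv0 ▸ hvm (lt_of_lt_of_le one_pos (le_max_right a 1))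
  have hne : -(2 * v x) ≠ 0 := by linarith
  have htop : Tendsto (secondDiff v x) atTop (𝓝 (-(2 * v x))) := by
    have h1 := hvtop.comp (tendsto_atTop_add_const_left atTop x tendsto_id)
    have h2 := hvbot.comp (tendsto_atBot_add_const_left atTop x tendsto_neg_atTop_atBot)
    have h3 := (h1.add h2).sub_const (2 * v x)
    rw [add_neg_cancel, zero_sub] at h3
    simp only [Function.comp_def, id, ← sub_eq_add_neg] at h3
    exact h3
  have hbot : Tendsto (secondDiff v x) atBot (𝓝 (-(2 * v x))) := by
    have := htop.comp tendsto_neg_atBot_atTop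
    simpa only [Function.comp_def, secondDiff_neg_right] using this
  exact hloc.integrable_of_isBigO_atBot_atTop
    (hO hne hbot) ((hint x (le_max_left a 1)).integrableAtFilter _)
    (hO hne htop) ((hint x (le_max_left a 1)).integrableAtFilter _)

/-- Liouville property: a nonnegative kernel whose operator annihilates a strictly increasing
layer function vanishes. -/
theorem ae_eq_zero_of_integral_secondDiff_mul_eq_zero {J v : ℝ → ℝ}
    (hJ0 : ∀ z, 0 ≤ J z) (hvc : Continuous v) (hvm : StrictMono v)
    {l l' : ℝ} (hvtop : Tendsto v atTop (𝓝 l)) (hvbot : Tendsto v atBot (𝓝 l'))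
    (hint : ∀ x, Integrable fun z => secondDiff v x z * J z)
    (hzero : ∀ x, ∫ z, secondDiff v x z * J z = 0) : ∀ᵐ z, J z = 0 := by
  by_contra hcon
  set S : Set ℝ := {z | J z ≠ 0} \ {0} with hS
  have hSpos : volume S ≠ 0 := by
    rw [hS, measure_sdiff_null (measure_singleton 0)]
    exact hcon
  obtain ⟨z, hzS, hz⟩ := exists_mem_forall_mem_nhdsWithin_pos_measure hSpos
  have hint' : ∀ x, Integrable fun y => secondDiff (fun y => v (y + 1)) x y * J y := fun x => by
    simpa only [secondDiff_comp_add_const] using hint (x + 1)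
  set d : ℝ → ℝ := fun x => v (x + 1) - v x with hd
  have hdc : Continuous d := by fun_prop
  have hdpos : 0 < d 0 := sub_pos.2 (hvm (by norm_num))
  obtain ⟨m, hm0, hm⟩ := exists_negative_min (w := fun x => -d x) (x := 0) (by fun_prop)
    (by simpa [hd] using (tendsto_increment_zero hvtop 1).neg)
    (by simpa [hd] using ((tendsto_comp_add_const_atBot hvbot 1).sub hvbot).neg)
    (neg_neg_of_pos hdpos)
  have hstep : ∀ x, d x = d m → d (x + |z|) = d m := by
    intro x hx
    have hle : ∀ y, secondDiff d x y ≤ 0 := fun y => by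
      have h1 := hm (x + y)
      have h2 := hm (x - y)
      simp only [secondDiff]
      linarith
    have hsplit : ∀ y, secondDiff d x y * J y =
        secondDiff (fun y => v (y + 1)) x y * J y - secondDiff v x y * J y := fun y => by
      rw [hd, secondDiff_sub, sub_mul]
    have hi : Integrable fun y => secondDiff d x y * J y := by
      simp only [hsplit]
      exact (hint' x).sub (hint x)
    have hae : ∫ y, secondDiff d x y * J y = 0 := by
      simp only [hsplit]
      rw [integral_sub (hint' x) (hint x)]
      simp only [secondDiff_comp_add_const, hzero, sub_zero]
    have hae' : ∀ᵐ y, secondDiff d x y * J y = 0 := by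
      have := (integral_eq_zero_iff_of_nonneg (f := fun y => -(secondDiff d x y * J y))
        (fun y => neg_nonneg.2 (mul_nonpos_of_nonpos_of_nonneg (hle y) (hJ0 y))) hi.neg).1
        (by rw [integral_neg, hae, neg_zero])
      filter_upwards [this] with y hy
      simpa using hy
    have hzz : secondDiff d x z = 0 := by
      by_contra hne
      have hmem : {y | secondDiff d x y ≠ 0} ∩ S ∈ 𝓝[S] z :=
        inter_mem (mem_nhdsWithin_of_mem_nhds
          ((continuous_secondDiff hdc x).continuousAt.eventually_ne hne)) self_mem_nhdsWithin
      refine (hz _ hmem).ne' (measure_mono_null ?_ hae')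
      rintro y ⟨hy1, hy2⟩
      exact mul_ne_zero hy1 hy2.1
    have h1 := hm (x + z)
    have h2 := hm (x - z)
    simp only [secondDiff] at hzz
    rcases abs_choice z with h | h <;> rw [h]
    · linarith
    · rw [← sub_eq_add_neg]
      linarith
  have h0 := eq_zero_of_periodic_of_tendsto_zero (tendsto_increment_zero hvtop 1) (x := m)
    (abs_pos.2 hzS.2) (by
      intro k
      induction k with
      | zero => simp
      | succ k ih =>
        have := hstep _ ih
        rw [show m + ((k + 1 : ℕ) : ℝ) * |z| = m + k * |z| + |z| by push_cast; ring]
        exact this)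
  have : d m = 0 := h0
  linarith

theorem nlEnergy_max_zero (K W v : ℝ → ℝ) (Ω : Set ℝ) :
    nlEnergy volume K W v Ω = nlEnergy volume (fun z => max (K z) 0) W v Ω := by
  unfold nlEnergy
  congr 3
  ext p
  rw [mul_max_of_nonneg _ _ (sq_nonneg _), mul_zero, ENNReal.ofReal_max, ENNReal.ofReal_zero,
    max_eq_left zero_le]

theorem nlEnergy_eq_ofReal {P W v : ℝ → ℝ} {Ω : Set ℝ} (hP : ∀ z, 0 ≤ P z) (hW : ∀ r, 0 ≤ W r)
    (h1 : IntegrableOn (fun p : ℝ × ℝ => (v p.1 - v p.2) ^ 2 * P (p.1 - p.2)) (Ωᶜ ×ˢ Ωᶜ)ᶜ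
      (volume.prod volume))
    (h2 : IntegrableOn (fun x => W (v x)) Ω) :
    nlEnergy volume P W v Ω = ENNReal.ofReal
      (1 / 4 * ∫ p in ((Ωᶜ ×ˢ Ωᶜ)ᶜ : Set (ℝ × ℝ)), (v p.1 - v p.2) ^ 2 * P (p.1 - p.2)
          ∂(volume.prod volume) + ∫ x in Ω, W (v x)) := by
  have h0 : ∀ p : ℝ × ℝ, 0 ≤ (v p.1 - v p.2) ^ 2 * P (p.1 - p.2) :=
    fun p => mul_nonneg (sq_nonneg _) (hP _)
  unfold nlEnergy
  rw [ENNReal.ofReal_add (mul_nonneg (by norm_num) (integral_nonneg h0))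
    (integral_nonneg fun x => hW _), ENNReal.ofReal_mul (by norm_num),
    ofReal_integral_eq_lintegral_ofReal h1 (ae_of_all _ h0),
    ofReal_integral_eq_lintegral_ofReal h2 (ae_of_all _ fun x => hW _)]
  congr 2
  rw [ENNReal.ofReal_div_of_pos (by norm_num)]
  norm_num

/-- A test function has finite interaction energy. -/
theorem integrable_sq_sub_mul_kernel {P φ : ℝ → ℝ} {q R : ℝ} (hP : Measurable P)
    (hP0 : ∀ z, 0 ≤ P z) (hq0 : 0 ≤ q) (hq2 : q ≤ 2)
    (hm : Integrable fun z => min 1 (|z| ^ q) * P z)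
    (hφ : ContDiff ℝ 1 φ) (hφc : HasCompactSupport φ) (hφR : ∀ x, x ∉ Ioo (-R) R → φ x = 0) :
    Integrable (fun p : ℝ × ℝ => (φ p.1 - φ p.2) ^ 2 * P (p.1 - p.2)) (volume.prod volume) := by
  set m : ℝ → ℝ := fun z => min 1 (|z| ^ q) * P z with hmdef
  set χ : ℝ → ℝ := indicator (Ioo (-R) R) 1 with hχ
  have hm0 : ∀ z, 0 ≤ m z := fun z => mul_nonneg (le_min zero_le_one (by positivity)) (hP0 z)
  have hχi : Integrable χ :=
    (integrable_indicator_iff measurableSet_Ioo).2 (by simp [Pi.one_def])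
  have hχ0 : ∀ x, 0 ≤ χ x := fun x => indicator_nonneg (fun _ _ => zero_le_one) x
  have hχ1 : ∀ x, φ x ≠ 0 → χ x = 1 := fun x hx =>
    indicator_of_mem (by_contra fun h => hx (hφR x h)) _
  have i1 : Integrable (fun p : ℝ × ℝ => χ p.2 * m (p.1 - p.2)) (volume.prod volume) := by
    simpa using hχi.convolution_integrand (ContinuousLinearMap.mul ℝ ℝ) hm
  have i2 : Integrable (fun p : ℝ × ℝ => χ p.1 * m (p.1 - p.2)) (volume.prod volume) := by
    have := (hχi.convolution_integrand (ContinuousLinearMap.mul ℝ ℝ) hm.comp_neg).swap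
    simpa [Function.comp_def] using this
  obtain ⟨B, hB⟩ := hφ.continuous.bounded_above_of_compact_support hφc
  obtain ⟨L, hL⟩ := hφ.lipschitzWith_of_hasCompactSupport hφc one_ne_zero
  have hB0 : 0 ≤ B := (norm_nonneg _).trans (hB 0)
  set C := max ((L : ℝ) ^ 2) ((2 * B) ^ 2) with hC
  have hC0 : 0 ≤ C := le_max_of_le_left (by positivity)
  have hbound : ∀ x y, (φ x - φ y) ^ 2 ≤ C * min 1 (|x - y| ^ q) := by
    intro x y
    rcases le_total |x - y| 1 with h | h
    · rw [min_eq_right (Real.rpow_le_one (abs_nonneg _) h hq0)]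
      have h1 := hL.dist_le_mul x y
      rw [Real.dist_eq, Real.dist_eq] at h1
      have h2 : |x - y| ^ (2 : ℝ) ≤ |x - y| ^ q := by
        rcases (abs_nonneg (x - y)).eq_or_lt with h0 | h0
        · rw [← h0, Real.zero_rpow two_ne_zero]
          positivity
        · exact Real.rpow_le_rpow_of_exponent_ge h0 h hq2
      calc (φ x - φ y) ^ 2 = |φ x - φ y| ^ 2 := (sq_abs _).symm
        _ ≤ (L * |x - y|) ^ 2 := by gcongr
        _ = (L : ℝ) ^ 2 * |x - y| ^ (2 : ℝ) := by rw [Real.rpow_two]; ring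
        _ ≤ C * |x - y| ^ q := by
          gcongr
          exact le_max_left _ _
    · rw [min_eq_left (Real.one_le_rpow h hq0), mul_one]
      refine le_trans ?_ (le_max_right _ _)
      rw [← sq_abs]
      have h1 : |φ x - φ y| ≤ 2 * B := (abs_sub _ _).trans (by
        have := hB x
        have := hB y
        simp only [Real.norm_eq_abs] at *
        linarith)
      gcongr
  refine ((i1.add i2).const_mul C).mono' ?_ (ae_of_all _ fun p => ?_)
  · have := hφ.continuous.measurable
    exact Measurable.aestronglyMeasurable (by fun_prop)
  · rw [Real.norm_eq_abs, abs_of_nonneg (mul_nonneg (sq_nonneg _) (hP0 _))]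
    simp only [Pi.add_apply]
    rcases eq_or_ne (φ p.1) 0 with h1 | h1
    · rcases eq_or_ne (φ p.2) 0 with h2 | h2
      · rw [h1, h2]
        simp only [sub_self, ne_eq, OfNat.ofNat_ne_zero, not_false_eq_true, zero_pow, zero_mul]
        have := hχ0 p.1
        have := hχ0 p.2
        have := hm0 (p.1 - p.2)
        positivity
      · rw [hχ1 _ h2, one_mul]
        have h3 := mul_nonneg (hχ0 p.1) (hm0 (p.1 - p.2))
        calc (φ p.1 - φ p.2) ^ 2 * P (p.1 - p.2)
            ≤ C * min 1 (|p.1 - p.2| ^ q) * P (p.1 - p.2) :=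
              mul_le_mul_of_nonneg_right (hbound _ _) (hP0 _)
          _ = C * m (p.1 - p.2) := by rw [hmdef]; ring
          _ ≤ _ := by gcongr; linarith
    · rw [hχ1 _ h1, one_mul]
      have h3 := mul_nonneg (hχ0 p.2) (hm0 (p.1 - p.2))
      calc (φ p.1 - φ p.2) ^ 2 * P (p.1 - p.2)
          ≤ C * min 1 (|p.1 - p.2| ^ q) * P (p.1 - p.2) :=
            mul_le_mul_of_nonneg_right (hbound _ _) (hP0 _)
        _ = C * m (p.1 - p.2) := by rw [hmdef]; ring
        _ ≤ _ := by gcongr; linarith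

/-- Integration by parts for the bilinear form associated with the kernel `P`. -/
theorem integral_sub_mul_sub_mul_kernel {P u φ : ℝ → ℝ} {m : ℝ → ℝ} {C : ℝ} (hP : Measurable P)
    (hP0 : ∀ z, 0 ≤ P z) (hm : Integrable fun z => m z * P z) (hu : Continuous u)
    (hφ : Continuous φ) (hφc : HasCompactSupport φ)
    (hbd : ∀ x z, φ x ≠ 0 → |secondDiff u x z| ≤ C * m z)
    (hint : Integrable (fun p : ℝ × ℝ => (u p.1 - u p.2) * (φ p.1 - φ p.2) * P (p.1 - p.2))
      (volume.prod volume)) :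
    Integrable (fun x => φ x * ∫ z, secondDiff u x z * P z) ∧
    ∫ p : ℝ × ℝ, (u p.1 - u p.2) * (φ p.1 - φ p.2) * P (p.1 - p.2) ∂(volume.prod volume) =
      -∫ x, φ x * ∫ z, secondDiff u x z * P z := by
  have hφi : Integrable φ := hφ.integrable_of_hasCompactSupport hφc
  have hG : Integrable (fun p : ℝ × ℝ => φ p.2 * (secondDiff u p.2 p.1 * P p.1))
      (volume.prod volume) := by
    refine ((hm.mul_prod hφi.norm).const_mul C).mono' ?_ (ae_of_all _ fun p => ?_)
    · have := hφ.measurable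
      have := hu.measurable
      unfold secondDiff
      exact Measurable.aestronglyMeasurable (by fun_prop)
    · simp only [norm_mul, Real.norm_eq_abs, abs_of_nonneg (hP0 _)]
      rcases eq_or_ne (φ p.2) 0 with h | h
      · simp [h]
      · have h1 := mul_le_mul_of_nonneg_left (hbd p.2 p.1 h)
          (mul_nonneg (abs_nonneg (φ p.2)) (hP0 p.1))
        linarith
  have hmp := measurePreserving_add_prod (volume : Measure ℝ) (volume : Measure ℝ)
  have hH : Integrable (fun p : ℝ × ℝ =>
      (u (p.1 + p.2) - u p.2) * (φ (p.1 + p.2) - φ p.2) * P p.1) (volume.prod volume) := by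
    have := (hmp.integrable_comp hint.aestronglyMeasurable).2 hint
    simpa [Function.comp_def] using this
  have hchange : ∫ p : ℝ × ℝ, (u p.1 - u p.2) * (φ p.1 - φ p.2) * P (p.1 - p.2)
      ∂(volume.prod volume) = ∫ p : ℝ × ℝ,
        (u (p.1 + p.2) - u p.2) * (φ (p.1 + p.2) - φ p.2) * P p.1 ∂(volume.prod volume) := by
    have := integral_map hmp.measurable.aemeasurable
      (f := fun p : ℝ × ℝ => (u p.1 - u p.2) * (φ p.1 - φ p.2) * P (p.1 - p.2))
      (by rw [hmp.map_eq]; exact hint.aestronglyMeasurable)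
    rw [hmp.map_eq] at this
    simpa using this
  have hinner : ∀ z, ∫ y, (u (z + y) - u y) * (φ (z + y) - φ y) * P z =
      -∫ y, φ y * (secondDiff u y z * P z) := by
    intro z
    have hu' : Continuous fun y => u (y + z) - u y := by fun_prop
    have hu'' : Continuous fun y => u y - u (y - z) := by fun_prop
    have e1 : ∫ y, (u (y + z) - u y) * φ (y + z) = ∫ y, (u y - u (y - z)) * φ y := by
      rw [← integral_add_right_eq_self (fun y => (u y - u (y - z)) * φ y) z]
      simp
    have k1 : Integrable fun y => (u (y + z) - u y) * φ y :=
      (hu'.mul hφ).integrable_of_hasCompactSupport hφc.mul_left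
    have k2 : Integrable fun y => (u y - u (y - z)) * φ y :=
      (hu''.mul hφ).integrable_of_hasCompactSupport hφc.mul_left
    have k3 : Integrable fun y => (u (y + z) - u y) * φ (y + z) := by
      have := k2.comp_add_right z
      simpa using this
    calc ∫ y, (u (z + y) - u y) * (φ (z + y) - φ y) * P z
        = (∫ y, ((u (y + z) - u y) * φ (y + z) - (u (y + z) - u y) * φ y)) * P z := by
          rw [← integral_mul_const]
          congr 1
          ext y
          rw [add_comm z y]
          ring
      _ = (∫ y, ((u y - u (y - z)) * φ y - (u (y + z) - u y) * φ y)) * P z := by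
          rw [integral_sub k3 k1, e1, ← integral_sub k2 k1]
      _ = -∫ y, φ y * (secondDiff u y z * P z) := by
          rw [← integral_mul_const, ← integral_neg]
          congr 1
          ext y
          simp only [secondDiff]
          ring
  refine ⟨by simpa only [integral_const_mul] using hG.integral_prod_right, ?_⟩
  rw [hchange, integral_prod _ hH]
  simp only [hinner]
  rw [integral_neg, integral_integral_swap hG]
  simp only [integral_const_mul]

/-- The energy of a bounded perturbation `u + t φ` is quadratic in `t`, up to the potential. -/
theorem nlEnergy_add_mul {P W u φ : ℝ → ℝ} {Ω : Set ℝ} (hP0 : ∀ z, 0 ≤ P z)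
    (hW0 : ∀ r, 0 ≤ W r)
    (iu : IntegrableOn (fun p : ℝ × ℝ => (u p.1 - u p.2) ^ 2 * P (p.1 - p.2)) (Ωᶜ ×ˢ Ωᶜ)ᶜ
      (volume.prod volume))
    (iuφ : IntegrableOn (fun p : ℝ × ℝ => (u p.1 - u p.2) * (φ p.1 - φ p.2) * P (p.1 - p.2))
      (Ωᶜ ×ˢ Ωᶜ)ᶜ (volume.prod volume))
    (iφ : IntegrableOn (fun p : ℝ × ℝ => (φ p.1 - φ p.2) ^ 2 * P (p.1 - p.2)) (Ωᶜ ×ˢ Ωᶜ)ᶜ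
      (volume.prod volume)) :
    ∃ I0 I2 : ℝ, ∀ t : ℝ, IntegrableOn (fun x => W (u x + t * φ x)) Ω →
      0 ≤ 1 / 4 * (I0 + 2 * t * (∫ p in ((Ωᶜ ×ˢ Ωᶜ)ᶜ : Set (ℝ × ℝ)),
          (u p.1 - u p.2) * (φ p.1 - φ p.2) * P (p.1 - p.2) ∂(volume.prod volume)) + t ^ 2 * I2)
          + ∫ x in Ω, W (u x + t * φ x) ∧
      nlEnergy volume P W (fun x => u x + t * φ x) Ω = ENNReal.ofReal
        (1 / 4 * (I0 + 2 * t * (∫ p in ((Ωᶜ ×ˢ Ωᶜ)ᶜ : Set (ℝ × ℝ)),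
          (u p.1 - u p.2) * (φ p.1 - φ p.2) * P (p.1 - p.2) ∂(volume.prod volume)) + t ^ 2 * I2)
          + ∫ x in Ω, W (u x + t * φ x)) := by
  refine ⟨∫ p in ((Ωᶜ ×ˢ Ωᶜ)ᶜ : Set (ℝ × ℝ)), (u p.1 - u p.2) ^ 2 * P (p.1 - p.2)
    ∂(volume.prod volume), ∫ p in ((Ωᶜ ×ˢ Ωᶜ)ᶜ : Set (ℝ × ℝ)),
    (φ p.1 - φ p.2) ^ 2 * P (p.1 - p.2) ∂(volume.prod volume), fun t iW => ?_⟩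
  have hsq : (fun p : ℝ × ℝ => ((u p.1 + t * φ p.1) - (u p.2 + t * φ p.2)) ^ 2 * P (p.1 - p.2)) =
      ((fun p => (u p.1 - u p.2) ^ 2 * P (p.1 - p.2)) +
        fun p => 2 * t * ((u p.1 - u p.2) * (φ p.1 - φ p.2) * P (p.1 - p.2))) +
        fun p => t ^ 2 * ((φ p.1 - φ p.2) ^ 2 * P (p.1 - p.2)) := by
    ext p
    simp only [Pi.add_apply]
    ring
  have i1 := iuφ.const_mul (2 * t)
  have i2 := iφ.const_mul (t ^ 2)
  have it : IntegrableOn (fun p : ℝ × ℝ =>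
      ((u p.1 + t * φ p.1) - (u p.2 + t * φ p.2)) ^ 2 * P (p.1 - p.2)) (Ωᶜ ×ˢ Ωᶜ)ᶜ
      (volume.prod volume) := by
    rw [hsq]
    exact (iu.add i1).add i2
  have hE := nlEnergy_eq_ofReal (v := fun x => u x + t * φ x) hP0 hW0 it iW
  have h0 : 0 ≤ 1 / 4 * (∫ p in ((Ωᶜ ×ˢ Ωᶜ)ᶜ : Set (ℝ × ℝ)),
      ((u p.1 + t * φ p.1) - (u p.2 + t * φ p.2)) ^ 2 * P (p.1 - p.2) ∂(volume.prod volume))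
      + ∫ x in Ω, W (u x + t * φ x) :=
    add_nonneg (mul_nonneg (by norm_num)
      (integral_nonneg fun p => mul_nonneg (sq_nonneg _) (hP0 _))) (integral_nonneg fun x => hW0 _)
  rw [hsq, integral_add' (iu.add i1) i2, integral_add' iu i1, integral_const_mul,
    integral_const_mul] at hE h0
  exact ⟨h0, hE⟩

theorem hasDerivAt_integral_potential {W u φ : ℝ → ℝ} (hW : ContDiff ℝ 1 W) (hu : Continuous u)
    (hu1 : ∀ x, |u x| ≤ 1) (hφ : Continuous φ) (hφc : HasCompactSupport φ) (R : ℝ) :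
    HasDerivAt (fun t => ∫ x in Ioo (-R) R, W (u x + t * φ x))
      (∫ x in Ioo (-R) R, φ x * deriv W (u x)) 0 := by
  have iW : ∀ f : ℝ → ℝ, Continuous f → IntegrableOn f (Ioo (-R) R) := fun f hf =>
    (hf.integrableOn_Icc (a := -R) (b := R)).mono_set Ioo_subset_Icc_self
  have hWc := hW.continuous
  obtain ⟨B, hB⟩ := hφ.bounded_above_of_compact_support hφc
  have hB0 : 0 ≤ B := (norm_nonneg _).trans (hB 0)
  have hW' : Continuous (deriv W) := hW.continuous_deriv le_rfl
  obtain ⟨D, hD⟩ := isCompact_Icc.exists_bound_of_continuousOn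
    (hW'.continuousOn (s := Icc (-(1 + B)) (1 + B)))
  have := (hasDerivAt_integral_of_dominated_loc_of_deriv_le
    (μ := volume.restrict (Ioo (-R) R)) (x₀ := (0 : ℝ))
    (F := fun t x => W (u x + t * φ x)) (F' := fun t x => φ x * deriv W (u x + t * φ x))
    (bound := fun _ => B * D) (Metric.ball_mem_nhds (0 : ℝ) one_pos)
    (Eventually.of_forall fun t => Continuous.aestronglyMeasurable (by fun_prop))
    (iW _ (by fun_prop)) (Continuous.aestronglyMeasurable (by fun_prop))
    (ae_of_all _ fun x t ht => ?_) (iW _ continuous_const) (ae_of_all _ fun x t _ => ?_)).2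
  · simpa only [zero_mul, add_zero] using this
  · rw [norm_mul]
    refine mul_le_mul (hB x) (hD _ (abs_le.1 ?_)) (norm_nonneg _) hB0
    rw [mem_ball_zero_iff, Real.norm_eq_abs] at ht
    refine (abs_add_le _ _).trans (add_le_add (hu1 x) ?_)
    rw [abs_mul]
    have := mul_le_mul ht.le (hB x) (norm_nonneg _) zero_le_one
    simpa using this
  · have h1 := (hW.differentiable one_ne_zero (u x + t * φ x)).hasDerivAt
    have h2 : HasDerivAt (fun t => u x + t * φ x) (φ x) t := by
      simpa using ((hasDerivAt_id t).mul_const (φ x)).const_add (u x)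
    exact (h1.comp t h2).congr_deriv (mul_comm _ _)

/-- Weak Euler–Lagrange equation for class A minimizers. -/
theorem IsClassAMinimizer.euler_lagrange {K W u φ : ℝ → ℝ} {q : ℝ} (hK : Measurable K)
    (hq0 : 0 ≤ q) (hq2 : q ≤ 2)
    (hm : Integrable fun z => min 1 (|z| ^ q) * max (K z) 0)
    (hW : ContDiff ℝ 1 W) (hW0 : ∀ r, 0 ≤ W r) (hu : Continuous u) (hu1 : ∀ x, |u x| ≤ 1)
    (hbd : ∀ R > 0, ∃ C, ∀ x z, |x| ≤ R → |secondDiff u x z| ≤ C * min 1 (|z| ^ q))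
    (hmin : IsClassAMinimizer volume K W u)
    (hφ : ContDiff ℝ 1 φ) (hφc : HasCompactSupport φ) :
    Integrable (fun x => φ x * ∫ z, secondDiff u x z * max (K z) 0) ∧
    ∫ x, φ x * deriv W (u x) = 1 / 2 * ∫ x, φ x * ∫ z, secondDiff u x z * max (K z) 0 := by
  obtain ⟨R, hR, hφR⟩ : ∃ R > 0, ∀ x, x ∉ Ioo (-R) R → φ x = 0 := by
    obtain ⟨R, hR, hsub⟩ := hφc.isCompact.isBounded.subset_ball_lt 0 0
    refine ⟨R, hR, fun x hx => image_eq_zero_of_notMem_tsupport fun h => hx ?_⟩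
    simpa [Real.ball_eq_Ioo] using hsub h
  set P : ℝ → ℝ := fun z => max (K z) 0 with hP
  have hPm : Measurable P := hK.max measurable_const
  have hP0 : ∀ z, 0 ≤ P z := fun z => le_max_right _ _
  set Ω := Ioo (-R) R with hΩ
  set A : Set (ℝ × ℝ) := (Ωᶜ ×ˢ Ωᶜ)ᶜ with hA
  obtain ⟨hfin, hle⟩ := hmin Ω isOpen_Ioo (isConnected_Ioo (by linarith)) (Metric.isBounded_Ioo _ _)
  simp only [nlEnergy_max_zero K, ← hP] at hfin hle
  have hum := hu.measurable
  have hφm := hφ.continuous.measurable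
  have iφ : IntegrableOn (fun p : ℝ × ℝ => (φ p.1 - φ p.2) ^ 2 * P (p.1 - p.2)) A
      (volume.prod volume) :=
    (integrable_sq_sub_mul_kernel hPm hP0 hq0 hq2 hm hφ hφc hφR).integrableOn
  have iu : IntegrableOn (fun p : ℝ × ℝ => (u p.1 - u p.2) ^ 2 * P (p.1 - p.2)) A
      (volume.prod volume) := by
    refine ⟨Measurable.aestronglyMeasurable (by fun_prop), ?_⟩
    rw [hasFiniteIntegral_iff_ofReal (ae_of_all _ fun p => mul_nonneg (sq_nonneg _) (hP0 _))]
    by_contra hcon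
    refine hfin ?_
    unfold nlEnergy
    rw [top_le_iff.1 (not_lt.1 hcon)]
    simp [ENNReal.mul_top]
  have iuφ : IntegrableOn (fun p : ℝ × ℝ => (u p.1 - u p.2) * (φ p.1 - φ p.2) * P (p.1 - p.2)) A
      (volume.prod volume) := by
    refine (iu.add iφ).mono' (Measurable.aestronglyMeasurable (by fun_prop))
      (ae_of_all _ fun p => ?_)
    rw [norm_mul, Real.norm_eq_abs, Real.norm_eq_abs, abs_of_nonneg (hP0 _), Pi.add_apply,
      ← add_mul]
    refine mul_le_mul_of_nonneg_right ?_ (hP0 _)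
    rw [abs_le]
    constructor <;> nlinarith [sq_nonneg (u p.1 - u p.2 + (φ p.1 - φ p.2)),
      sq_nonneg (u p.1 - u p.2 - (φ p.1 - φ p.2))]
  have hsupp : Function.support
      (fun p : ℝ × ℝ => (u p.1 - u p.2) * (φ p.1 - φ p.2) * P (p.1 - p.2)) ⊆ A := by
    intro p hp hpA
    exact hp (by simp [hφR _ hpA.1, hφR _ hpA.2])
  have iuφ' := (integrableOn_iff_integrable_of_support_subset hsupp).1 iuφ
  obtain ⟨C, hC⟩ := hbd R hR
  obtain ⟨hparts_int, hparts⟩ := integral_sub_mul_sub_mul_kernel hPm hP0 hm hu hφ.continuous hφc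
    (fun x z hx => hC x z (abs_le.2 (Ioo_subset_Icc_self (by_contra fun h => hx (hφR x h))))) iuφ'
  refine ⟨hparts_int, ?_⟩
  rw [← setIntegral_eq_integral_of_forall_compl_eq_zero
    (fun p hp => Function.notMem_support.1 fun h => hp (hsupp h))] at hparts
  obtain ⟨I0, I2, hE⟩ := nlEnergy_add_mul (W := W) hP0 hW0 iu iuφ iφ
  rw [hparts] at hE
  have hWc := hW.continuous
  have hφcont := hφ.continuous
  have hE' := fun t : ℝ => hE t ((Continuous.integrableOn_Icc (a := -R) (b := R)
    (by fun_prop)).mono_set Ioo_subset_Icc_self)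
  clear_value P
  generalize hI1 : ∫ x, φ x * ∫ z, secondDiff u x z * P z = I1 at hE'
  have hmin0 := fun t : ℝ => by
    have hle' := hle (fun x => u x + t * φ x) (by fun_prop)
      (ae_of_all _ fun x hx => by rw [hφR x hx, mul_zero, add_zero])
    have h0 : u = fun x => u x + 0 * φ x := by simp
    rw [(hE' t).2] at hle'
    nth_rewrite 1 [h0] at hle'
    rw [(hE' 0).2] at hle'
    exact (ENNReal.ofReal_le_ofReal_iff (hE' t).1).1 hle'
  have hpoly : HasDerivAt (fun t : ℝ => 1 / 4 * (I0 + 2 * t * -I1 + t ^ 2 * I2))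
      (-(1 / 2 * I1)) 0 := by
    have h1 : HasDerivAt (fun t : ℝ => 2 * t * -I1) (2 * -I1) 0 := by
      simpa using ((hasDerivAt_id (0 : ℝ)).const_mul 2).mul_const (-I1)
    have h2 : HasDerivAt (fun t : ℝ => t ^ 2 * I2) 0 0 := by
      simpa using (hasDerivAt_pow 2 (0 : ℝ)).mul_const I2
    exact (((h1.const_add I0).add h2).const_mul (1 / 4)).congr_deriv (by ring)
  have hzero := IsLocalMin.hasDerivAt_eq_zero (Eventually.of_forall hmin0)
    (hpoly.add (hasDerivAt_integral_potential hW hu hu1 hφ.continuous hφc R))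
  rw [setIntegral_eq_integral_of_forall_compl_eq_zero fun x hx => by rw [hφR x hx, zero_mul]]
    at hzero
  have hI1' : I1 = ∫ x, φ x * ∫ z, secondDiff u x z * max (K z) 0 := by rw [← hI1, hP]
  linarith

theorem KernelK2.ae_le {K : ℝ → ℝ} {s lam Lam r0 : ℝ} (hK : KernelK2 volume K 1 s lam Lam r0) :
    ∀ᵐ z, K z ≤ Lam * |z| ^ (-1 - 2 * s) := by
  filter_upwards [hK] with z hz
  simpa using hz.1

theorem KernelK2.ae_pos {K : ℝ → ℝ} {s lam Lam r0 : ℝ} (hlam : 0 < lam)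
    (hK : KernelK2 volume K 1 s lam Lam r0) : ∀ᵐ z, |z| < r0 → 0 < K z := by
  filter_upwards [hK, Measure.ae_ne volume (0 : ℝ)] with z hz hz0 hzr
  have hz' : 0 < |z| := abs_pos.2 hz0
  exact lt_of_lt_of_le (mul_pos hlam (Real.rpow_pos_of_pos hz' _)) (hz.2 hzr)

theorem abs_secondDiff_le {f : ℝ → ℝ} (hf : ∀ x, |f x| ≤ 1) (x z : ℝ) :
    |secondDiff f x z| ≤ 4 := by
  have h1 := abs_le.1 (hf (x + z))
  have h2 := abs_le.1 (hf (x - z))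
  have h3 := abs_le.1 (hf x)
  rw [secondDiff, abs_le]
  constructor <;> linarith

theorem integrable_secondDiff_mul_of_bound {f P : ℝ → ℝ} {q C x : ℝ} (hf : Continuous f)
    (hP : Measurable P) (hP0 : ∀ᵐ z, 0 ≤ P z)
    (hm : Integrable fun z => min 1 (|z| ^ q) * P z)
    (hC : ∀ z, |secondDiff f x z| ≤ C * min 1 (|z| ^ q)) :
    Integrable fun z => secondDiff f x z * P z := by
  refine (hm.const_mul C).mono'
    ((continuous_secondDiff hf x).measurable.mul hP).aestronglyMeasurable ?_
  filter_upwards [hP0] with z hz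
  rw [norm_mul, Real.norm_eq_abs, Real.norm_eq_abs, abs_of_nonneg hz, ← mul_assoc]
  exact mul_le_mul_of_nonneg_right (hC z) hz

/-- A class A minimizer only sees the positive part of the kernel, so if it also solves the
equation with the full kernel, then the negative part must vanish. -/
theorem IsClassAMinimizer.ae_nonneg_kernel {K W u : ℝ → ℝ} {q r0 : ℝ} (hK : Measurable K)
    (hq0 : 0 ≤ q) (hq2 : q ≤ 2) (hr0 : 0 < r0)
    (hKpos : ∀ᵐ z, |z| < r0 → 0 < K z)
    (hm : Integrable fun z => min 1 (|z| ^ q) * max (K z) 0)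
    (hW : ContDiff ℝ 2 W) (hW0 : ∀ r, 0 ≤ W r) (hW1 : deriv W 1 = 0)
    (hW1' : 0 < deriv (deriv W) 1)
    (hu : Continuous u) (hur : ∀ x, u x ∈ Ioo (-1 : ℝ) 1) (hum : StrictMono u) (hu0 : u 0 = 0)
    (hutop : Tendsto u atTop (𝓝 1)) (hubot : Tendsto u atBot (𝓝 (-1)))
    (hbd : ∀ R > 0, ∃ C, ∀ x z, |x| ≤ R → |secondDiff u x z| ≤ C * min 1 (|z| ^ q))
    (hmin : IsClassAMinimizer volume K W u)
    (hsol : ∀ x, opLK volume K u x = deriv W (u x)) : ∀ᵐ z, 0 ≤ K z := by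
  have hu1 : ∀ x, |u x| ≤ 1 := fun x => abs_le.2 (Ioo_subset_Icc_self (hur x))
  have hW' : ContDiff ℝ 1 (deriv W) := by
    have : ContDiff ℝ (1 + 1) W := by simpa [one_add_one_eq_two] using hW
    exact (contDiff_succ_iff_deriv.1 this).2.2
  set J : ℝ → ℝ := fun z => max (-K z) 0 with hJ
  have hJm : Measurable J := hK.neg.max measurable_const
  have hJ0 : ∀ z, 0 ≤ J z := fun z => le_max_right _ _
  have hKJ : ∀ z, K z = max (K z) 0 - J z := fun z => by
    simp only [hJ]
    rcases le_total (K z) 0 with h | h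
    · rw [max_eq_right h, max_eq_left (by linarith)]; ring
    · rw [max_eq_left h, max_eq_right (by linarith)]; ring
  have hintP : ∀ x, Integrable fun z => secondDiff u x z * max (K z) 0 := fun x => by
    obtain ⟨C, hC⟩ := hbd (|x| + 1) (by positivity)
    exact integrable_secondDiff_mul_of_bound hu (hK.max measurable_const)
      (ae_of_all _ fun z => le_max_right _ _) hm fun z => hC x z (by linarith)
  obtain ⟨δ, hδ, hmono⟩ := exists_strictMonoOn_of_deriv_pos hW' hW1'
  obtain ⟨a, ha⟩ := (hutop.eventually (lt_mem_nhds (by linarith : 1 - δ < 1))).exists_forall_of_atTop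
  have hJint : Integrable J := by
    refine integrable_of_integrable_secondDiff_mul (a := a) hr0 hJm ?_ hu hum hu0 hutop hubot
      fun x hx => ?_
    · filter_upwards [hKpos] with z hz hzr
      exact max_eq_right (by linarith [hz hzr])
    · have hne : deriv W (u x) < 0 := by
        rw [← hW1]
        exact hmono ⟨(ha x hx).le, by linarith [(hur x).2]⟩ ⟨by linarith, by linarith⟩ (hur x).2
      have hKi : Integrable fun z => secondDiff u x z * K z := by
        by_contra h
        have h1 := hsol x
        rw [opLK_eq_secondDiff, integral_undef h] at h1
        linarith
      refine ((hintP x).sub hKi).congr (ae_of_all _ fun z => ?_)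
      simp only [Pi.sub_apply]
      linear_combination -secondDiff u x z * hKJ z
  have hbdJ : ∀ x z, ‖secondDiff u x z * J z‖ ≤ 4 * J z := fun x z => by
    rw [norm_mul, Real.norm_eq_abs, Real.norm_eq_abs, abs_of_nonneg (hJ0 z)]
    exact mul_le_mul_of_nonneg_right (abs_secondDiff_le hu1 x z) (hJ0 z)
  have hmeasJ : ∀ x, AEStronglyMeasurable (fun z => secondDiff u x z * J z) volume := fun x =>
    ((continuous_secondDiff hu x).measurable.mul hJm).aestronglyMeasurable
  have hintJ : ∀ x, Integrable fun z => secondDiff u x z * J z := fun x =>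
    (hJint.const_mul 4).mono' (hmeasJ x) (ae_of_all _ (hbdJ x))
  set g : ℝ → ℝ := fun x => ∫ z, secondDiff u x z * J z with hg
  have hgc : Continuous g := by
    refine continuous_of_dominated hmeasJ (fun x => ae_of_all _ (hbdJ x)) (hJint.const_mul 4)
      (ae_of_all _ fun z => ?_)
    unfold secondDiff
    fun_prop
  have hPg : ∀ x, ∫ z, secondDiff u x z * max (K z) 0 = 2 * deriv W (u x) + g x := fun x => by
    have h1 := hsol x
    rw [opLK_eq_secondDiff] at h1
    have h2 : ∫ z, secondDiff u x z * K z =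
        (∫ z, secondDiff u x z * max (K z) 0) - ∫ z, secondDiff u x z * J z := by
      rw [← integral_sub (hintP x) (hintJ x)]
      refine integral_congr_ae (ae_of_all _ fun z => ?_)
      linear_combination secondDiff u x z * hKJ z
    simp only [hg]
    linarith
  have hWc : Continuous (deriv W) := hW'.continuous
  have hg0 : g =ᵐ[volume] 0 := by
    refine ae_eq_zero_of_integral_contDiff_smul_eq_zero hgc.locallyIntegrable
      fun φ hφ hφc => ?_
    have hφ1 : ContDiff ℝ 1 φ := hφ.of_le (by exact_mod_cast le_top)
    have hφcont := hφ1.continuous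
    obtain ⟨-, hEL⟩ := hmin.euler_lagrange hK hq0 hq2 hm (hW.of_le (by norm_num)) hW0 hu hu1 hbd
      hφ1 hφc
    have i1 : Integrable fun x => φ x * deriv W (u x) :=
      (by fun_prop : Continuous fun x => φ x * deriv W (u x)).integrable_of_hasCompactSupport
        hφc.mul_right
    have i2 : Integrable fun x => φ x * g x :=
      (by fun_prop : Continuous fun x => φ x * g x).integrable_of_hasCompactSupport
        hφc.mul_right
    have h3 : ∫ x, φ x * ∫ z, secondDiff u x z * max (K z) 0 =
        2 * (∫ x, φ x * deriv W (u x)) + ∫ x, φ x * g x := by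
      rw [← integral_const_mul, ← integral_add (i1.const_mul 2) i2]
      refine integral_congr_ae (ae_of_all _ fun x => ?_)
      simp only [hPg]
      ring
    simp only [smul_eq_mul]
    linarith
  have hgz : g = 0 := (hgc.ae_eq_iff_eq volume continuous_const).1 hg0
  filter_upwards [ae_eq_zero_of_integral_secondDiff_mul_eq_zero hJ0 hu hum hutop hubot hintJ
    (fun x => congrFun hgz x)] with z hz
  have := le_max_left (-K z) 0
  simp only [hJ] at hz
  linarith

/-- Theorem 1 (uniqueness part): the minimizer `u₀` of Theorem 1 is, up to translations, the
unique non-decreasing solution of `L_K u = W'(u)` in the class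
`X = {f ∈ L¹_loc(ℝ) : lim_{±∞} f = ±1}`. -/
theorem theorem1_uniqueness
    (s lam Lam r0 : ℝ) (hs0 : 0 < s) (hs1 : s < 1)
    (hlam : 0 < lam) (hlamLam : lam ≤ Lam) (hr0 : 0 < r0)
    (K : ℝ → ℝ) (hKmeas : Measurable K)
    (hK1 : KernelSymm volume K) (hK2 : KernelK2 volume K 1 s lam Lam r0)
    (W : ℝ → ℝ) (hWreg : ∃ β > 0, IsC2HolderLoc β W)
    (hWnonneg : ∀ r, 0 ≤ W r)
    (hW1 : ∀ r ∈ Ioo (-1 : ℝ) 1, 0 < W r)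
    (hW2a : W 1 = 0) (hW2b : W (-1) = 0)
    (hW2c : deriv W 1 = 0) (hW2d : deriv W (-1) = 0)
    (hW3a : 0 < deriv (deriv W) 1) (hW3b : 0 < deriv (deriv W) (-1))
    (hW4 : ∀ r ∈ Icc (-1 : ℝ) 1, W (-r) = W r)
    -- `u₀` is the minimizer given by Theorem 1:
    (u0 : ℝ → ℝ)
    (hu0range : ∀ x, u0 x ∈ Ioo (-1 : ℝ) 1)
    (hu0odd : ∀ x, u0 (-x) = -u0 x)
    (hu0mono : StrictMono u0)
    (hu0zero : u0 0 = 0)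
    (hu0top : Tendsto u0 atTop (𝓝 1)) (hu0bot : Tendsto u0 atBot (𝓝 (-1)))
    (hu0reg : ∃ α > 0, IsCHolder (1 + 2 * s + α) u0)
    (hu0min : IsClassAMinimizer volume K W u0)
    (hu0sol : ∀ x : ℝ, opLK volume K u0 x = deriv W (u0 x))
    -- a competitor `u`, non-decreasing, in `X ∩ L¹_s(ℝ) ∩ C^{2s+γ}_loc(ℝ)`, solving the equation:
    (u : ℝ → ℝ) (humono : Monotone u)
    (huloc : LocallyIntegrable u volume)
    (hutop : Tendsto u atTop (𝓝 1)) (hubot : Tendsto u atBot (𝓝 (-1)))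
    (huL1s : ∫⁻ x : ℝ, ENNReal.ofReal (|u x| / (1 + |x| ^ (1 + 2 * s))) ≠ ⊤)
    (hureg : ∃ γ > 0, ∀ R : ℝ, 0 < R → IsCHolderOn (2 * s + γ) u (Ioo (-R) R))
    (husol : ∀ x : ℝ, opLK volume K u x = deriv W (u x)) :
    ∃ x0 : ℝ, ∀ x : ℝ, u x = u0 (x - x0) := by
  obtain ⟨β, -, hW, -⟩ := hWreg
  obtain ⟨α, hα, hu0reg⟩ := hu0reg
  obtain ⟨γ, hγ, hureg⟩ := hureg
  have hW' : ContDiff ℝ 1 (deriv W) := by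
    have : ContDiff ℝ (1 + 1) W := by simpa [one_add_one_eq_two] using hW
    exact (contDiff_succ_iff_deriv.1 this).2.2
  have hKpos := hK2.ae_pos hlam
  have hKle := hK2.ae_le
  have hu0reg' : ∀ R : ℝ, 0 < R → IsCHolderOn (1 + 2 * s + α) u0 (Ioo (-R) R) :=
    fun R _ => hu0reg.isCHolderOn isOpen_Ioo
  have hu0c := continuous_of_isCHolderOn hu0reg'
  have huc := continuous_of_isCHolderOn hureg
  have hu01 : ∀ x, |u0 x| ≤ 1 := fun x => abs_le.2 (Ioo_subset_Icc_self (hu0range x))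
  have hu1 : ∀ x, |u x| ≤ 1 := fun x =>
    abs_le.2 ⟨humono.le_of_tendsto hubot x, humono.ge_of_tendsto hutop x⟩
  have hu0bd := fun R (hR : 0 < R) =>
    exists_abs_secondDiff_le_min (by linarith : 0 < 1 + 2 * s + α) hu0reg' hu01 hR
  have hubd := fun R (hR : 0 < R) =>
    exists_abs_secondDiff_le_min (by linarith : 0 < 2 * s + γ) hureg hu1 hR
  have hq0 : 2 * s < min (1 + 2 * s + α) 2 := lt_min (by linarith) (by linarith)
  have hq : 2 * s < min (2 * s + γ) 2 := lt_min (by linarith) (by linarith)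
  have hK0 : ∀ᵐ z, 0 ≤ K z := by
    refine hu0min.ae_nonneg_kernel hKmeas (by linarith : 0 ≤ min (1 + 2 * s + α) 2)
      (min_le_right _ _) hr0 hKpos ?_ hW hWnonneg hW2c hW3a hu0c hu0range hu0mono hu0zero hu0top
      hu0bot (fun R hR => (hu0bd R hR).imp fun C hC => hC.2) hu0sol
    refine integrable_min_mul_kernel (hKmeas.max measurable_const) hs0 hq0
      (ae_of_all _ fun z => le_max_right _ _) (Lam := Lam) ?_
    filter_upwards [hKle] with z hz
    exact max_le hz (mul_nonneg (hlam.le.trans hlamLam) (Real.rpow_nonneg (abs_nonneg z) _))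
  have hint : ∀ {f : ℝ → ℝ} {q : ℝ}, 2 * s < q → Continuous f →
      (∀ R, 0 < R → ∃ C, 0 ≤ C ∧ ∀ x z, |x| ≤ R → |secondDiff f x z| ≤ C * min 1 (|z| ^ q)) →
      ∀ x, Integrable fun z => secondDiff f x z * K z := fun {f q} hq hf hbd x => by
    obtain ⟨C, -, hC⟩ := hbd (|x| + 1) (by positivity)
    exact integrable_secondDiff_mul_of_bound hf hKmeas hK0
      (integrable_min_mul_kernel hKmeas hs0 hq hK0 hKle) fun z => hC x z (by linarith)
  exact exists_translation_of_nonneg_kernel hr0 hK0 hKpos hW' hW3a hW3b hu0c hu0mono.monotone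
    (hu0range 0).1 hu0top hu0bot (hint hq0 hu0c hu0bd) hu0sol huc humono hutop hubot
    (hint hq huc hubd) husol

end
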